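/- arXiv:2007.05941 — 2 statements merged into one kernel-verified Lean document; each statement's English description precedes it below -/
import Mathlib

section
/- Let n be a square-free integer. Then the action on A(n) of the subgroup of permutations of A(n) generated by x and w₂ has finitely many orbits. Consequently the action of the subgroup generated by x and w₁ also has finitely many orbits. -/
/-- The set `A(n) = {(a,b,c) : bc = a^2 - n}`. -/
def Aset (n : ℤ) : Set (ℤ × ℤ × ℤ) := {p | p.2.1 * p.2.2 = p.1 ^ 2 - n}

/-- The map `x(a,b,c) = (-a, c, b)` on triples. -/
def xMap : ℤ × ℤ × ℤ → ℤ × ℤ × ℤ := fun p => (-p.1, p.2.2, p.2.1)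

/-- The map `w_k(a,b,c) = (a + kc, 2ka + b + k^2 c, c)` on triples. -/
def wMap (k : ℤ) : ℤ × ℤ × ℤ → ℤ × ℤ × ℤ :=
  fun p => (p.1 + k * p.2.2, 2 * k * p.1 + p.2.1 + k ^ 2 * p.2.2, p.2.2)

/-- `A(n)` as a type. -/
abbrev AT (n : ℤ) : Type := {p : ℤ × ℤ × ℤ // p.2.1 * p.2.2 = p.1 ^ 2 - n}

/-- The map `x(a,b,c) = (-a, c, b)` as a permutation of `A(n)`. -/
def xPerm (n : ℤ) : Equiv.Perm (AT n) where
  toFun := fun ⟨(a, b, c), h⟩ => ⟨(-a, c, b), by dsimp at h ⊢; linear_combination h⟩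
  invFun := fun ⟨(a, b, c), h⟩ => ⟨(-a, c, b), by dsimp at h ⊢; linear_combination h⟩
  left_inv := fun ⟨(a, b, c), h⟩ => by simp
  right_inv := fun ⟨(a, b, c), h⟩ => by simp

/-- The map `w_k(a,b,c) = (a + kc, 2ka + b + k^2 c, c)` as a permutation of `A(n)`. -/
def wPerm (n k : ℤ) : Equiv.Perm (AT n) where
  toFun := fun ⟨(a, b, c), h⟩ =>
    ⟨(a + k * c, 2 * k * a + b + k ^ 2 * c, c), by dsimp at h ⊢; linear_combination h⟩
  invFun := fun ⟨(a, b, c), h⟩ =>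
    ⟨(a - k * c, -(2 * k) * a + b + k ^ 2 * c, c), by dsimp at h ⊢; linear_combination h⟩
  left_inv := fun ⟨(a, b, c), h⟩ => by
    apply Subtype.ext; dsimp; exact Prod.ext (by ring) (Prod.ext (by ring) rfl)
  right_inv := fun ⟨(a, b, c), h⟩ => by
    apply Subtype.ext; dsimp; exact Prod.ext (by ring) (Prod.ext (by ring) rfl)

/-- The subgroup of permutations of `A(n)` generated by `x` and `w_λ`. -/
def Hgrp (n lam : ℤ) : Subgroup (Equiv.Perm (AT n)) :=
  Subgroup.closure {xPerm n, wPerm n lam}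

theorem wPerm_add (n i j : ℤ) : wPerm n (i + j) = wPerm n i * wPerm n j := by
  ext ⟨⟨a, b, c⟩, h⟩ : 2
  exact Prod.ext (by simp [wPerm]; ring) (Prod.ext (by simp [wPerm]; ring) rfl)

/-- The maps `w_k` form a one-parameter group of permutations. -/
def wHom (n : ℤ) : Multiplicative ℤ →* Equiv.Perm (AT n) :=
  MonoidHom.mk' (fun k => wPerm n k.toAdd) fun i j => wPerm_add n i.toAdd j.toAdd

theorem wPerm_mul_mem_Hgrp (n lam k : ℤ) : wPerm n (k * lam) ∈ Hgrp n lam := by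
  have h := map_zpow (wHom n) (Multiplicative.ofAdd lam) k
  rw [← ofAdd_zsmul, smul_eq_mul] at h
  change wPerm n (k * lam) = (wPerm n lam) ^ k at h
  rw [h]
  exact Subgroup.zpow_mem _ (Subgroup.subset_closure (by simp)) k

theorem xPerm_mem_Hgrp (n lam : ℤ) : xPerm n ∈ Hgrp n lam :=
  Subgroup.subset_closure (by simp)

theorem Hgrp_mul_le (n lam k : ℤ) : Hgrp n (k * lam) ≤ Hgrp n lam := by
  refine (Subgroup.closure_le _).2 ?_
  rintro g (rfl | rfl)
  · exact xPerm_mem_Hgrp n lam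
  · exact wPerm_mul_mem_Hgrp n lam k

/-- The points of `A(n)` with all coordinates bounded by `B` in absolute value. -/
def box (n B : ℤ) : Set (AT n) := {p | |p.1.1| ≤ B ∧ |p.1.2.1| ≤ B ∧ |p.1.2.2| ≤ B}

theorem finite_box (n B : ℤ) : (box n B).Finite := by
  refine Set.Finite.subset (Set.Finite.preimage Subtype.val_injective.injOn
    ((Set.finite_Icc (-B) B).prod ((Set.finite_Icc (-B) B).prod (Set.finite_Icc (-B) B)))) ?_
  rintro p ⟨ha, hb, hc⟩
  exact ⟨abs_le.1 ha, abs_le.1 hb, abs_le.1 hc⟩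

theorem exists_abs_add_mul_le (a : ℤ) {c : ℤ} (hc : c ≠ 0) : ∃ k : ℤ, |a + k * 2 * c| ≤ |c| := by
  have hpos := abs_pos.2 hc
  obtain ⟨k, hk⟩ : ∃ k : ℤ, |a + k * 2 * (|c|)| ≤ |c| := by
    refine ⟨-((a + |c|) / (2 * |c|)), abs_le.2 ?_⟩
    have h1 := Int.emod_add_mul_ediv (a + |c|) (2 * |c|)
    have h2 := Int.emod_nonneg (a + |c|) (b := 2 * |c|) (by omega)
    have h3 := Int.emod_lt_of_pos (a + |c|) (b := 2 * |c|) (by omega)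
    constructor <;> nlinarith
  rcases abs_choice c with h | h
  · exact ⟨k, by rwa [h] at hk ⊢⟩
  · refine ⟨-k, ?_⟩
    rw [h] at hk ⊢
    rwa [show a + -k * 2 * c = a + k * 2 * -c by ring]

/-- Reduced points with `c ≠ 0` have bounded coordinates. -/
theorem abs_le_of_reduced {n a b c : ℤ} (hn : n ≠ 0) (h : b * c = a ^ 2 - n) (hc : c ≠ 0)
    (hac : |a| ≤ |c|) (hcb : |c| ≤ |b|) :
    |a| ≤ |n| + 1 ∧ |b| ≤ (|n| + 1) ^ 2 + |n| ∧ |c| ≤ |n| + 1 := by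
  have hcpos : 1 ≤ |c| := Int.one_le_abs hc
  have ha0 := abs_nonneg a
  have hbc : |b| * |c| = |a ^ 2 - n| := by rw [← abs_mul, h]
  have ha2 : |a| ^ 2 = a ^ 2 := sq_abs a
  have hc2 : |c| * |c| ≤ |b| * |c| := by gcongr
  have hle : |a ^ 2 - n| ≤ |a| ^ 2 + |n| := by
    rw [ha2]
    exact (abs_sub _ _).trans (by rw [abs_of_nonneg (sq_nonneg a)])
  have hb : |b| ≤ |b| * |c| := le_mul_of_one_le_right (abs_nonneg b) hcpos
  suffices hcn : |c| ≤ |n| + 1 by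
    refine ⟨hac.trans hcn, ?_, hcn⟩
    have : |a| ^ 2 ≤ (|n| + 1) ^ 2 := by gcongr; exact hac.trans hcn
    linarith
  rcases hac.eq_or_lt with hac | hac
  · have hdvd : c ∣ n := by
      have h1 : c ∣ a ^ 2 := ((abs_dvd_abs c a).1 (hac ▸ dvd_rfl)).trans (dvd_pow_self a two_ne_zero)
      rw [show n = a ^ 2 - b * c by linarith]
      exact dvd_sub h1 (dvd_mul_left c b)
    have := Int.le_of_dvd (abs_pos.2 hn) ((abs_dvd_abs c n).2 hdvd)
    omega
  · nlinarith

theorem abs_le_of_sq_eq {n a : ℤ} (h : a ^ 2 = n) : |a| ≤ |n| := by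
  rw [← h, abs_pow]
  rcases (abs_nonneg a).eq_or_lt with h0 | h0 <;> nlinarith

/-- Every `H(2)`-orbit meets a box that depends only on `n`. -/
theorem exists_mem_box {n : ℤ} (hn : n ≠ 0) (p : AT n) :
    ∃ g ∈ Hgrp n 2, g p ∈ box n ((|n| + 1) ^ 2 + |n|) := by
  classical
  have hex : ∃ m : ℕ, ∃ g ∈ Hgrp n 2, (g p).1.2.2.natAbs = m := ⟨_, 1, one_mem _, rfl⟩
  obtain ⟨g, hg, hgm⟩ := Nat.find_spec hex
  have hmin : ∀ g' ∈ Hgrp n 2, (g p).1.2.2.natAbs ≤ (g' p).1.2.2.natAbs := fun g' hg' =>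
    hgm ▸ Nat.find_min' hex ⟨g', hg', rfl⟩
  have hn0 := abs_pos.2 hn
  by_cases hc : (g p).1.2.2 = 0
  · have hq := (g p).2
    rw [hc, mul_zero] at hq
    have hsq : (g p).1.1 ^ 2 = n := by linarith
    have han := abs_le_of_sq_eq hsq
    have ha : (g p).1.1 ≠ 0 := by
      rintro h0
      rw [h0] at hsq
      exact hn (by simpa using hsq.symm)
    obtain ⟨k, hk⟩ := exists_abs_add_mul_le (g p).1.2.1 (c := 2 * (g p).1.1) (by omega)
    refine ⟨wPerm n (k * 2) * g, mul_mem (wPerm_mul_mem_Hgrp n 2 k) hg, ?_⟩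
    change |(g p).1.1 + k * 2 * (g p).1.2.2| ≤ _ ∧
      |2 * (k * 2) * (g p).1.1 + (g p).1.2.1 + (k * 2) ^ 2 * (g p).1.2.2| ≤ _ ∧ |(g p).1.2.2| ≤ _
    rw [hc, abs_zero, mul_zero, mul_zero, add_zero, add_zero,
      show 2 * (k * 2) * (g p).1.1 + (g p).1.2.1 = (g p).1.2.1 + k * 2 * (2 * (g p).1.1) by ring]
    rw [abs_mul 2, abs_two] at hk
    refine ⟨?_, ?_, ?_⟩ <;> nlinarith
  · obtain ⟨k, hk⟩ := exists_abs_add_mul_le (g p).1.1 hc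
    have hw := mul_mem (wPerm_mul_mem_Hgrp n 2 k) hg
    have hswap := hmin _ (mul_mem (xPerm_mem_Hgrp n 2) hw)
    refine ⟨_, hw, ?_⟩
    obtain ⟨h1, h2, h3⟩ := abs_le_of_reduced hn ((wPerm n (k * 2) * g) p).2 hc hk
      (by rw [Int.abs_eq_natAbs, Int.abs_eq_natAbs]; exact Int.ofNat_le.2 hswap)
    exact ⟨by nlinarith, h2, by nlinarith⟩

theorem finite_orbitRel_quotient {n : ℤ} (hn : n ≠ 0) {G : Subgroup (Equiv.Perm (AT n))}
    (hG : Hgrp n 2 ≤ G) : Finite (Quotient (MulAction.orbitRel ↥G (AT n))) := by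
  have := (finite_box n ((|n| + 1) ^ 2 + |n|)).to_subtype
  refine Finite.of_surjective
    (fun q : box n ((|n| + 1) ^ 2 + |n|) => Quotient.mk (MulAction.orbitRel ↥G (AT n)) q.1) ?_
  intro q
  induction q using Quotient.inductionOn with
  | h p =>
    obtain ⟨g, hg, hgp⟩ := exists_mem_box hn p
    exact ⟨⟨g p, hgp⟩, Quotient.sound ⟨⟨g, hG hg⟩, rfl⟩⟩

theorem stmt7 (n : ℤ) (hsf : Squarefree n) :
    Finite (Quotient (MulAction.orbitRel ↥(Hgrp n 2) (AT n))) ∧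
      Finite (Quotient (MulAction.orbitRel ↥(Hgrp n 1) (AT n))) :=
  ⟨finite_orbitRel_quotient hsf.ne_zero le_rfl,
    finite_orbitRel_quotient hsf.ne_zero (Hgrp_mul_le n 1 2)⟩
end

section
/- Let ε := (5 − √7)/3, let n be an integer and λ ≥ 3 an integer. Suppose (a',b',c') ∈ A(n) satisfies a' > 0, a'² − n > 0, b' > ε·a' and c' > ε·a', and suppose (a,b,c) ∈ A(n) satisfies |a| < a'. Then (a,b,c) does not lie in the orbit of (a',b',c') under the subgroup of permutations of A(n) generated by x and w_λ. -/
/-- The constant `ε = (5 - √7)/3 ≈ 0.78`. -/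
noncomputable def eps : ℝ := (5 - Real.sqrt 7) / 3

theorem eps_quadratic : 3 * eps ^ 2 = 10 * eps - 6 := by
  have h : Real.sqrt 7 ^ 2 = 7 := Real.sq_sqrt (by norm_num)
  unfold eps
  linear_combination h / 3

theorem two_thirds_lt_eps : 2 / 3 < eps := by
  have h : Real.sqrt 7 < 3 := (Real.sqrt_lt' (by norm_num)).2 (by norm_num)
  unfold eps
  linarith

theorem eps_lt_one : eps < 1 := by
  have h : 2 < Real.sqrt 7 := Real.lt_sqrt_of_sq_lt (by norm_num)
  unfold eps
  linarith

theorem expansion_of_three_le {a b c t : ℝ} (hb : 0 < b) (hc : eps * |a| < c) (ht : 3 ≤ t) :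
    |a| ≤ |a + t * c| ∧ eps * |a + t * c| < 2 * t * a + b + t ^ 2 * c := by
  have h1 := two_thirds_lt_eps
  have h2 := eps_lt_one
  have ha := abs_nonneg a
  have hna := neg_abs_le a
  have hs : (t * eps - 1) * |a| ≤ a + t * c := by nlinarith
  have hle : |a| ≤ a + t * c := by
    refine le_trans (le_mul_of_one_le_left ha ?_) hs
    nlinarith
  rw [abs_of_nonneg (ha.trans hle)]
  refine ⟨hle, ?_⟩
  have hcoef : t ≤ (t - eps) * (t * eps - 1) := by
    have hfac : (t - eps) * (t * eps - 1) - t = eps * ((t - 3) * (t - 1 / 3)) := by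
      linear_combination (-t / 3) * eps_quadratic
    have : 0 ≤ eps * ((t - 3) * (t - 1 / 3)) :=
      mul_nonneg (by linarith) (mul_nonneg (by linarith) (by linarith))
    linarith
  have hmul := mul_le_mul_of_nonneg_left hs (show 0 ≤ t - eps by linarith)
  have hmul' := mul_le_mul_of_nonneg_right hcoef ha
  have hta : 0 ≤ t * (a + |a|) := mul_nonneg (by linarith) (by linarith)
  linarith

theorem expansion_of_three_le_abs {a b c t : ℝ} (hb : 0 < b) (hc : eps * |a| < c)
    (ht : 3 ≤ |t|) :
    |a| ≤ |a + t * c| ∧ eps * |a + t * c| < 2 * t * a + b + t ^ 2 * c := by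
  rcases le_abs'.1 ht with h | h
  · have key := expansion_of_three_le (a := -a) (t := -t) hb (by rwa [abs_neg]) (by linarith)
    rw [show -a + -t * c = -(a + t * c) by ring, abs_neg, abs_neg] at key
    exact ⟨key.1, by linarith [key.2]⟩
  · exact expansion_of_three_le hb hc h

theorem xMap_xMap (p : ℤ × ℤ × ℤ) : xMap (xMap p) = p := by
  simp [xMap]

theorem wMap_wMap (s t : ℤ) (p : ℤ × ℤ × ℤ) : wMap s (wMap t p) = wMap (s + t) p := by
  refine Prod.ext ?_ (Prod.ext ?_ rfl) <;> simp only [wMap] <;> ring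

theorem wMap_zero (p : ℤ × ℤ × ℤ) : wMap 0 p = p := by
  simp [wMap]

/-- The triples reached from `q` by a word in `x` and nonzero powers of `w_lam` that alternates
and ends with an application of `x`, together with `q` itself. -/
inductive AltReach (lam : ℤ) (q : ℤ × ℤ × ℤ) : ℤ × ℤ × ℤ → Prop
  | base : AltReach lam q q
  | flip : AltReach lam q (xMap q)
  | step {d : ℤ × ℤ × ℤ} {k : ℤ} (hd : AltReach lam q d) (hk : k ≠ 0) :
      AltReach lam q (xMap (wMap (lam * k) d))

/-- The triples of the form `w_lam ^ k d` with `d` reached from `q` by an alternating word. -/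
def Reach (lam : ℤ) (q p : ℤ × ℤ × ℤ) : Prop :=
  ∃ d k, AltReach lam q d ∧ wMap (lam * k) d = p

theorem AltReach.reach {lam : ℤ} {q d : ℤ × ℤ × ℤ} (hd : AltReach lam q d) : Reach lam q d :=
  ⟨d, 0, hd, by rw [mul_zero, wMap_zero]⟩

theorem Reach.wMap_mul {lam : ℤ} {q p : ℤ × ℤ × ℤ} (h : Reach lam q p) (j : ℤ) :
    Reach lam q (wMap (lam * j) p) := by
  obtain ⟨d, k, hd, rfl⟩ := h
  exact ⟨d, j + k, hd, by rw [wMap_wMap, mul_add]⟩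

theorem Reach.flip {lam : ℤ} {q p : ℤ × ℤ × ℤ} (h : Reach lam q p) :
    Reach lam q (xMap p) := by
  obtain ⟨d, k, hd, rfl⟩ := h
  by_cases hk : k = 0
  · subst hk
    rw [mul_zero, wMap_zero]
    cases hd with
    | base => exact AltReach.flip.reach
    | flip => exact (xMap_xMap q).symm ▸ AltReach.base.reach
    | step hd _ => exact ⟨_, _, hd, (xMap_xMap _).symm⟩
  · exact (hd.step hk).reach

theorem expansion_wMap {lam k : ℤ} (hlam : 3 ≤ lam) (hk : k ≠ 0) {p : ℤ × ℤ × ℤ}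
    (hb : 0 < p.2.1) (hc : eps * |(p.1 : ℝ)| < p.2.2) :
    |p.1| ≤ |(wMap (lam * k) p).1| ∧
      eps * |((wMap (lam * k) p).1 : ℝ)| < (wMap (lam * k) p).2.1 := by
  have ht : 3 ≤ |lam * k| := by
    rw [abs_mul, abs_of_nonneg (by linarith : 0 ≤ lam)]
    nlinarith [Int.one_le_abs hk]
  have key := expansion_of_three_le_abs (a := p.1) (b := p.2.1) (c := p.2.2)
    (t := (lam * k : ℤ)) (by exact_mod_cast hb) hc (by exact_mod_cast ht)
  refine ⟨by simpa only [wMap] using by exact_mod_cast key.1, ?_⟩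
  have h2 := key.2
  simp only [wMap]
  push_cast at h2 ⊢
  exact h2

theorem AltReach.bounds {lam : ℤ} (hlam : 3 ≤ lam) {q d : ℤ × ℤ × ℤ}
    (hb : eps * |(q.1 : ℝ)| < q.2.1) (hc : eps * |(q.1 : ℝ)| < q.2.2)
    (hd : AltReach lam q d) :
    |q.1| ≤ |d.1| ∧ 0 < d.2.1 ∧ eps * |(d.1 : ℝ)| < d.2.2 := by
  have pos_of_lt {a c : ℤ} (h : eps * |(a : ℝ)| < c) : 0 < c := by
    have : 0 ≤ eps * |(a : ℝ)| :=
      mul_nonneg (by linarith [two_thirds_lt_eps]) (abs_nonneg _)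
    exact_mod_cast this.trans_lt h
  induction hd with
  | base => exact ⟨le_rfl, pos_of_lt hb, hc⟩
  | flip => exact ⟨by simp [xMap], pos_of_lt hc, by simpa [xMap] using hb⟩
  | step _ hk ih =>
    obtain ⟨h1, h2, h3⟩ := ih
    obtain ⟨h4, h5⟩ := expansion_wMap hlam hk h2 h3
    refine ⟨?_, pos_of_lt h3, ?_⟩
    · simpa only [xMap, abs_neg] using h1.trans h4
    · simpa only [xMap, Int.cast_neg, abs_neg] using h5

theorem Reach.abs_le {lam : ℤ} (hlam : 3 ≤ lam) {q p : ℤ × ℤ × ℤ}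
    (hb : eps * |(q.1 : ℝ)| < q.2.1) (hc : eps * |(q.1 : ℝ)| < q.2.2)
    (hp : Reach lam q p) : |q.1| ≤ |p.1| := by
  obtain ⟨d, k, hd, rfl⟩ := hp
  obtain ⟨h1, h2, h3⟩ := hd.bounds hlam hb hc
  by_cases hk : k = 0
  · rwa [hk, mul_zero, wMap_zero]
  · exact h1.trans (expansion_wMap hlam hk h2 h3).1

theorem reach_smul_iff {n lam : ℤ} (q : ℤ × ℤ × ℤ) {g : Equiv.Perm (AT n)}
    (hg : g ∈ Hgrp n lam) (p : AT n) : Reach lam q (g p).1 ↔ Reach lam q p.1 := by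
  induction hg using Subgroup.closure_induction generalizing p with
  | mem g hg =>
    rcases hg with rfl | rfl
    · have hx : (xPerm n p).1 = xMap p.1 := rfl
      rw [hx]
      exact ⟨fun h => xMap_xMap p.1 ▸ h.flip, fun h => h.flip⟩
    · have hw : (wPerm n lam p).1 = wMap lam p.1 := rfl
      rw [hw]
      refine ⟨fun h => ?_, fun h => by simpa using h.wMap_mul 1⟩
      have := h.wMap_mul (-1)
      rwa [wMap_wMap, show lam * -1 + lam = 0 by ring, wMap_zero] at this
  | one => rfl
  | mul g₁ g₂ _ _ h₁ h₂ => rw [Equiv.Perm.mul_apply, h₁, h₂]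
  | inv g _ h => simpa using (h (g⁻¹ p)).symm

theorem stmt10 (n lam : ℤ) (hlam : 3 ≤ lam) (α' : AT n)
    (ha : 0 < α'.1.1) (hn : 0 < α'.1.1 ^ 2 - n)
    (hb : (α'.1.2.1 : ℝ) > eps * (α'.1.1 : ℝ))
    (hc : (α'.1.2.2 : ℝ) > eps * (α'.1.1 : ℝ))
    (α : AT n) (hsmall : |α.1.1| < α'.1.1) :
    α ∉ MulAction.orbit ↥(Hgrp n lam) α' := by
  rintro ⟨⟨g, hg⟩, rfl⟩
  have habs : |(α'.1.1 : ℝ)| = α'.1.1 := abs_of_pos (by exact_mod_cast ha)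
  have hreach : Reach lam α'.1 (g α').1 := (reach_smul_iff _ hg α').2 AltReach.base.reach
  have hle := hreach.abs_le hlam (by rwa [habs]) (by rwa [habs])
  rw [abs_of_pos ha] at hle
  exact hsmall.not_ge hle
end
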